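/- (Theorem 1, deterministic form.) Let M ≥ 1 be an integer, h > 0, θ₀ ≥ 0, and let a₁, …, a_M be reals and b₁, …, b_M be positive reals. Define r_j, C_j, D_j as in the main parametrization, and define recursively ρ_{M+1}(s) = s and ρ_j(s) = r_j(ρ_{j+1}(s)) for j = M, …, 1. Then for every real s such that D_j(s) > 0 for all 1 ≤ j ≤ M + 1 and b_j − ρ_{j+1}(s)(1 − e^{-h}) > 0 for all 1 ≤ j ≤ M, the M-step chained moment-generating function satisfies exp(θ₀ ρ₁(s)) · Π_{j=1}^{M} C_j(ρ_{j+1}(s)) = exp(θ₀ s e^{-Mh} / D₁(s)) · Π_{m=1}^{M} (D_m(s)/D_{m+1}(s))^{-a_m}. -/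

import Mathlib

open Finset Real

/-- One-step map of the control variate-based stochastic Cox–Ingersoll–Ross process
(main parametrization): `r_j(s) = s b_j e^{-h} / (b_j − s(1 − e^{-h}))`. -/
noncomputable def scirR (h : ℝ) (b : ℕ → ℝ) (j : ℕ) (s : ℝ) : ℝ :=
  s * b j * Real.exp (-h) / (b j - s * (1 - Real.exp (-h)))

/-- Denominator `D_j(s) = 1 − s(1 − e^{-h}) Σ_{l=1}^{M−j+1} e^{-(l−1)h} / b_{M−l+1}`,
with the convention `D_{M+1}(s) = 1` (empty sum). -/
noncomputable def scirD (h : ℝ) (b : ℕ → ℝ) (M j : ℕ) (s : ℝ) : ℝ :=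
  1 - s * (1 - Real.exp (-h)) *
      ∑ l ∈ Finset.Icc 1 (M + 1 - j), Real.exp (-((l : ℝ) - 1) * h) / b (M - l + 1)

/-- `iterComp r j k s = r_j (r_{j+1} (⋯ (r_{j+k-1} s)))`: the composition of `k`
consecutive one-step maps starting at index `j`, applied to `s`. -/
def iterComp (r : ℕ → ℝ → ℝ) : ℕ → ℕ → ℝ → ℝ
  | _, 0, s => s
  | j, k + 1, s => r j (iterComp r (j + 1) k s)

/-- Coefficient function `C_j(u) = ((b_j − u(1 − e^{-h}))/b_j)^{-a_j}` of the main
parametrization. -/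
noncomputable def scirC (h : ℝ) (b a : ℕ → ℝ) (j : ℕ) (u : ℝ) : ℝ :=
  ((b j - u * (1 - Real.exp (-h))) / b j) ^ (-(a j))

/-- Backward recursion for the denominators. -/
theorem scirD_eq_sub (h : ℝ) (b : ℕ → ℝ) {M j k : ℕ} (hj : 1 ≤ j) (hjk : j + k = M)
    (s : ℝ) :
    scirD h b M j s =
      scirD h b M (j + 1) s - s * (1 - Real.exp (-h)) * (Real.exp (-(k : ℝ) * h) / b j) := by
  subst hjk
  have h₁ : j + k + 1 - j = k + 1 := by omega
  have h₂ : j + k + 1 - (j + 1) = k := by omega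
  have h₃ : j + k - (k + 1) + 1 = j := by omega
  unfold scirD
  rw [h₁, h₂, Finset.sum_Icc_succ_top (by omega)]
  rw [h₃]
  push_cast
  rw [add_sub_cancel_right]
  ring

/-- The quantity raised to a power in `scirC` is a quotient of consecutive denominators. -/
theorem sub_mul_div_eq_scirD_div (h : ℝ) (b : ℕ → ℝ) {M j k : ℕ} (hj : 1 ≤ j) (hjk : j + k = M)
    (s : ℝ) (hb : b j ≠ 0) (hD : scirD h b M (j + 1) s ≠ 0) :
    (b j - s * Real.exp (-(k : ℝ) * h) / scirD h b M (j + 1) s * (1 - Real.exp (-h))) / b j =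
      scirD h b M j s / scirD h b M (j + 1) s := by
  rw [scirD_eq_sub h b hj hjk]
  field_simp

/-- Closed form of the composition of the last `k` one-step maps. -/
theorem iterComp_scirR (h : ℝ) (b : ℕ → ℝ) (M : ℕ) (s : ℝ)
    (hb : ∀ j, 1 ≤ j → j ≤ M → b j ≠ 0)
    (hD : ∀ j, 1 ≤ j → j ≤ M + 1 → scirD h b M j s ≠ 0) (k : ℕ) :
    ∀ j, 1 ≤ j → j + k = M + 1 →
      iterComp (scirR h b) j k s = s * Real.exp (-(k : ℝ) * h) / scirD h b M j s := by
  induction k with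
  | zero =>
    intro j _ hjk
    obtain rfl : j = M + 1 := by omega
    simp [iterComp, scirD]
  | succ k ih =>
    intro j hj hjk
    have hbj := hb j hj (by omega)
    have hDj := hD j hj (by omega)
    have hDj' := hD (j + 1) (by omega) (by omega)
    have key := sub_mul_div_eq_scirD_div h b hj (by omega : j + k = M) s hbj hDj'
    rw [div_eq_iff hbj] at key
    have hexp : Real.exp (-((k + 1 : ℕ) : ℝ) * h) = Real.exp (-(k : ℝ) * h) * Real.exp (-h) := by
      rw [← Real.exp_add]
      push_cast
      ring_nf
    rw [iterComp, ih (j + 1) (by omega) (by omega), scirR, key, hexp]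
    field_simp

/-- Theorem 1 (deterministic form): the `M`-step chained moment-generating function
of the control variate-based stochastic Cox–Ingersoll–Ross process, main
parametrization.  Here `ρ_j(s) = iterComp (scirR h b) j (M + 1 - j) s` satisfies the
recursion `ρ_{M+1}(s) = s`, `ρ_j(s) = r_j(ρ_{j+1}(s))`. -/
theorem scirCV_mgf_M_steps (M : ℕ) (hM : 1 ≤ M) (h θ₀ : ℝ) (hh : 0 < h) (hθ : 0 ≤ θ₀)
    (a b : ℕ → ℝ) (hb : ∀ j, 1 ≤ j → j ≤ M → 0 < b j) (s : ℝ)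
    (hD : ∀ j, 1 ≤ j → j ≤ M + 1 → 0 < scirD h b M j s)
    (hpos : ∀ j, 1 ≤ j → j ≤ M →
      0 < b j - iterComp (scirR h b) (j + 1) (M - j) s * (1 - Real.exp (-h))) :
    Real.exp (θ₀ * iterComp (scirR h b) 1 M s) *
        ∏ j ∈ Finset.Icc 1 M, scirC h b a j (iterComp (scirR h b) (j + 1) (M - j) s) =
      Real.exp (θ₀ * s * Real.exp (-(M : ℝ) * h) / scirD h b M 1 s) *
        ∏ m ∈ Finset.Icc 1 M, (scirD h b M m s / scirD h b M (m + 1) s) ^ (-(a m)) := by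
  have hb' : ∀ j, 1 ≤ j → j ≤ M → b j ≠ 0 := fun j h₁ h₂ => (hb j h₁ h₂).ne'
  have hD' : ∀ j, 1 ≤ j → j ≤ M + 1 → scirD h b M j s ≠ 0 := fun j h₁ h₂ => (hD j h₁ h₂).ne'
  rw [iterComp_scirR h b M s hb' hD' M 1 le_rfl (by omega), ← mul_div_assoc, ← mul_assoc]
  congr 1
  refine Finset.prod_congr rfl fun j hj => ?_
  obtain ⟨h₁, h₂⟩ := Finset.mem_Icc.mp hj
  rw [iterComp_scirR h b M s hb' hD' (M - j) (j + 1) (by omega) (by omega), scirC,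
    sub_mul_div_eq_scirD_div h b h₁ (by omega) s (hb' j h₁ h₂) (hD' (j + 1) (by omega) (by omega))]
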